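/- arXiv:2308.11502 — 2 statements merged into one kernel-verified Lean document; each statement's English description precedes it below -/
import Mathlib

section
/- The assignments [n] ↦ ⟨n⟩ and, for φ:[n]→[m] in Δ, |φ|:⟨m⟩→⟨n⟩ defined by |φ|(i) = j if φ(j−1) < i ≤ φ(j) for some j∈{1,…,n} and |φ|(i) = 0 otherwise, define a functor |–|:Δᵒᵖ→ℱ*; that is, |id_{[n]}| = id_{⟨n⟩} and |φ'∘φ| = |φ|∘|φ'| for composable φ:[n]→[m], φ':[m]→[k] in Δ. Moreover, if φ is inert in Δ then |φ| is inert in ℱ*, and if φ is active in Δ then |φ| is active in ℱ*. -/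
open CategoryTheory Limits

universe w v u v' u' v'' u''

/-- Objects of the skeleton `ℱ*` of finite pointed sets: `⟨n⟩ = ({0,1,…,n},0)`. -/
structure FinPtd where
  n : ℕ

namespace FinPtd

/-- Morphisms of `ℱ*` are basepoint-preserving maps. -/
instance : Category FinPtd where
  Hom a b := {f : Fin (a.n + 1) → Fin (b.n + 1) // f 0 = 0}
  id a := ⟨id, rfl⟩
  comp f g := ⟨g.1 ∘ f.1, by simp [Function.comp, f.2, g.2]⟩
  id_comp f := rfl
  comp_id f := rfl
  assoc f g h := rfl

/-- A morphism `φ : ⟨n⟩ → ⟨m⟩` is inert if every `j ∈ {1,…,m}` has exactly one preimage. -/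
def Inert {a b : FinPtd} (φ : a ⟶ b) : Prop :=
  ∀ j : Fin (b.n + 1), j ≠ 0 → ∃! i : Fin (a.n + 1), φ.1 i = j

/-- A morphism `φ : ⟨n⟩ → ⟨m⟩` is active if `φ⁻¹(0) = {0}`. -/
def Active {a b : FinPtd} (φ : a ⟶ b) : Prop :=
  ∀ i : Fin (a.n + 1), φ.1 i = 0 → i = 0

/-- The inert morphism `ρᵢ : ⟨n⟩ → ⟨1⟩` (for `1 ≤ i ≤ n`) sending `i` to `1` and everything
else to the basepoint. -/
def rho (n i : ℕ) : FinPtd.mk n ⟶ FinPtd.mk 1 :=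
  ⟨fun j => if j.1 = i ∧ 1 ≤ i then 1 else 0, by
    have h : ¬((0 : Fin (n + 1)).1 = i ∧ 1 ≤ i) := by
      simp only [Fin.val_zero]
      omega
    exact if_neg h⟩

/-- The class of inert morphisms of `ℱ*`. -/
def inertProp : MorphismProperty FinPtd := fun _ _ f => Inert f

/-- The class of active morphisms of `ℱ*`. -/
def activeProp : MorphismProperty FinPtd := fun _ _ f => Active f

end FinPtd

/-- An orthogonal factorization system `(L, R)` on a category: both classes contain all
isomorphisms, are closed under composition, every morphism factors as a morphism in `L`
followed by a morphism in `R`, and `L` is left orthogonal to `R` with unique diagonal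
fillers (which makes the factorization unique up to unique compatible isomorphism). -/
structure IsOFS {C : Type u} [Category.{v} C] (L R : MorphismProperty C) : Prop where
  iso_left : ∀ {X Y : C} (f : X ⟶ Y), IsIso f → L f
  iso_right : ∀ {X Y : C} (f : X ⟶ Y), IsIso f → R f
  comp_left : ∀ {X Y Z : C} (f : X ⟶ Y) (g : Y ⟶ Z), L f → L g → L (f ≫ g)
  comp_right : ∀ {X Y Z : C} (f : X ⟶ Y) (g : Y ⟶ Z), R f → R g → R (f ≫ g)
  factor : ∀ {X Y : C} (f : X ⟶ Y), ∃ (Z : C) (l : X ⟶ Z) (r : Z ⟶ Y), L l ∧ R r ∧ l ≫ r = f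
  lift_unique : ∀ {A B X Y : C} (l : A ⟶ B) (r : X ⟶ Y) (u : A ⟶ X) (v : B ⟶ Y),
      L l → R r → l ≫ v = u ≫ r → ∃! d : B ⟶ X, l ≫ d = u ∧ d ≫ r = v
/-- A morphism `φ : [n] → [m]` of the simplex category `Δ` is inert if
`φ(i) = φ(0) + i` for all `i` (a subinterval inclusion). -/
def DInert {a b : SimplexCategory} (φ : a ⟶ b) : Prop :=
  ∀ i : Fin (a.len + 1), (φ.toOrderHom i).1 = (φ.toOrderHom 0).1 + i.1

/-- A morphism `φ : [n] → [m]` of the simplex category `Δ` is active if it is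
boundary-preserving: `φ(0) = 0` and `φ(n) = m`. -/
def DActive {a b : SimplexCategory} (φ : a ⟶ b) : Prop :=
  φ.toOrderHom 0 = 0 ∧ φ.toOrderHom (Fin.last a.len) = Fin.last b.len

def DInertProp : MorphismProperty SimplexCategory := fun _ _ f => DInert f
def DActiveProp : MorphismProperty SimplexCategory := fun _ _ f => DActive f

/-- The functor `|–| : Δᵒᵖ → ℱ*` on morphisms: for `φ : [n] → [m]` in `Δ`,
`|φ| : ⟨m⟩ → ⟨n⟩` sends `i` to `j` if `φ(j−1) < i ≤ φ(j)` for some `j`, and to the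
basepoint otherwise. -/
noncomputable def deltaAbs {n m : ℕ} (φ : SimplexCategory.mk n ⟶ SimplexCategory.mk m) :
    FinPtd.mk m ⟶ FinPtd.mk n :=
  ⟨fun i =>
    if h : ∃ j : Fin (n + 1), j.1 ≠ 0 ∧
        (φ.toOrderHom ⟨j.1 - 1, lt_of_le_of_lt (Nat.sub_le _ _) j.isLt⟩).1 < i.1 ∧
        i.1 ≤ (φ.toOrderHom j).1
    then h.choose else 0,
  by
    have h : ¬ ∃ j : Fin (n + 1), j.1 ≠ 0 ∧
        (φ.toOrderHom ⟨j.1 - 1, lt_of_le_of_lt (Nat.sub_le _ _) j.isLt⟩).1 <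
          ((0 : Fin (m + 1))).1 ∧
        ((0 : Fin (m + 1))).1 ≤ (φ.toOrderHom j).1 := by
      rintro ⟨j, hj, h1, h2⟩
      simp only [Fin.val_zero] at h1
      exact absurd h1 (Nat.not_lt_zero _)
    exact dif_neg h⟩

/-- The inert morphism `σᵢ : [1] → [n]` in `Δ`, `σᵢ(t) = t + i − 1`, for `1 ≤ i ≤ n`. -/
def sigmaMap (n i : ℕ) (h1 : 1 ≤ i) (h2 : i ≤ n) :
    SimplexCategory.mk 1 ⟶ SimplexCategory.mk n :=
  SimplexCategory.Hom.mk
    ⟨fun t => ⟨t.1 + i - 1, by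
        show t.1 + i - 1 < n + 1
        have ht : t.1 < 2 := t.isLt
        omega⟩,
     fun a b hab => by
       simp only [Fin.mk_le_mk]
       have hab' : a.1 ≤ b.1 := hab
       omega⟩

/-- The predecessor `j - 1` in `Fin (n + 1)`, truncated at `0`. -/
def finPred {n : ℕ} (j : Fin (n + 1)) : Fin (n + 1) :=
  ⟨j.1 - 1, lt_of_le_of_lt (Nat.sub_le _ _) j.isLt⟩

lemma le_finPred_of_lt {n : ℕ} {i j : Fin (n + 1)} (h : i < j) : i ≤ finPred j := by
  have h' : i.1 < j.1 := h
  change i.1 ≤ j.1 - 1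
  omega

lemma finPred_lt {n : ℕ} {j : Fin (n + 1)} (h : j ≠ 0) : finPred j < j := by
  have h' : j.1 ≠ 0 := fun h0 => h (Fin.ext h0)
  change j.1 - 1 < j.1
  omega

/-- For `j ≠ 0`, `|φ|(i) = j` exactly when `φ(j - 1) < i ≤ φ(j)`. -/
lemma deltaAbs_eq_iff {n m : ℕ} (φ : SimplexCategory.mk n ⟶ SimplexCategory.mk m)
    (i : Fin (m + 1)) {j : Fin (n + 1)} (hj : j ≠ 0) :
    (deltaAbs φ).1 i = j ↔ φ.toOrderHom (finPred j) < i ∧ i ≤ φ.toOrderHom j := by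
  have mono : Monotone φ.toOrderHom := φ.toOrderHom.monotone
  have val_ne : ∀ {j : Fin (n + 1)}, j ≠ 0 → j.1 ≠ 0 := fun h h0 => h (Fin.ext h0)
  constructor
  · intro h
    unfold deltaAbs at h
    dsimp only at h
    split_ifs at h with hex
    · have hs := hex.choose_spec
      rw [h] at hs
      exact ⟨hs.2.1, hs.2.2⟩
    · exact absurd h.symm hj
  · rintro ⟨h1, h2⟩
    have hex : ∃ j : Fin (n + 1), j.1 ≠ 0 ∧
        (φ.toOrderHom ⟨j.1 - 1, lt_of_le_of_lt (Nat.sub_le _ _) j.isLt⟩).1 < i.1 ∧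
        i.1 ≤ (φ.toOrderHom j).1 := ⟨j, val_ne hj, h1, h2⟩
    have hval : (deltaAbs φ).1 i = hex.choose := dif_pos hex
    obtain ⟨-, c1, c2⟩ := hex.choose_spec
    rw [hval]
    rcases lt_trichotomy hex.choose j with hlt | heq | hgt
    · exact absurd (lt_of_lt_of_le h1 (le_trans c2 (mono (le_finPred_of_lt hlt)))) (lt_irrefl _)
    · exact heq
    · exact absurd (lt_of_lt_of_le c1 (le_trans h2 (mono (le_finPred_of_lt hgt)))) (lt_irrefl _)

/-- If `φ(a) < i ≤ φ(b)` then `a < |φ|(i) ≤ b`. -/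
lemma deltaAbs_mem_Ioc {n m : ℕ} (φ : SimplexCategory.mk n ⟶ SimplexCategory.mk m)
    {i : Fin (m + 1)} {a b : Fin (n + 1)}
    (ha : φ.toOrderHom a < i) (hb : i ≤ φ.toOrderHom b) :
    a < (deltaAbs φ).1 i ∧ (deltaAbs φ).1 i ≤ b := by
  have mono : Monotone φ.toOrderHom := φ.toOrderHom.monotone
  obtain ⟨p, hp, hmin⟩ := WellFounded.has_min (wellFounded_lt (α := Fin (n + 1)))
    {p | i ≤ φ.toOrderHom p} ⟨b, hb⟩
  have hap : a < p := by
    by_contra h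
    exact absurd (lt_of_lt_of_le ha (le_trans hp (mono (not_lt.1 h)))) (lt_irrefl _)
  have hp0 : p ≠ 0 := fun h => absurd (h ▸ hap) (Fin.not_lt_zero a)
  have hval : (deltaAbs φ).1 i = p := (deltaAbs_eq_iff φ i hp0).2
    ⟨not_le.1 fun h => hmin (finPred p) h (finPred_lt hp0), hp⟩
  rw [hval]
  exact ⟨hap, not_lt.1 (hmin b hb)⟩

/-- Elements of `Fin (n + 1)` are equal if they agree as soon as one of them is nonzero. -/
lemma fin_eq_of_forall_ne_zero {n : ℕ} {x y : Fin (n + 1)}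
    (h : ∀ j : Fin (n + 1), j ≠ 0 → (x = j ↔ y = j)) : x = y := by
  by_cases hx : x = 0
  · by_cases hy : y = 0
    · rw [hx, hy]
    · exact (h y hy).2 rfl
  · exact ((h x hx).1 rfl).symm

lemma deltaAbs_id (n : ℕ) : deltaAbs (𝟙 (SimplexCategory.mk n)) = 𝟙 (FinPtd.mk n) := by
  refine Subtype.ext (funext fun i => fin_eq_of_forall_ne_zero fun j hj => ?_)
  refine (deltaAbs_eq_iff _ i hj).trans ?_
  change finPred j < i ∧ i ≤ j ↔ i = j
  constructor
  · rintro ⟨h1, h2⟩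
    exact le_antisymm h2
      (not_lt.1 fun h => absurd (lt_of_lt_of_le h1 (le_finPred_of_lt h)) (lt_irrefl _))
  · rintro rfl
    exact ⟨finPred_lt hj, le_rfl⟩

lemma deltaAbs_comp {n m k : ℕ} (φ : SimplexCategory.mk n ⟶ SimplexCategory.mk m)
    (φ' : SimplexCategory.mk m ⟶ SimplexCategory.mk k) :
    deltaAbs (φ ≫ φ') = deltaAbs φ' ≫ deltaAbs φ := by
  have mono : Monotone φ'.toOrderHom := φ'.toOrderHom.monotone
  refine Subtype.ext (funext fun i => fin_eq_of_forall_ne_zero fun j hj => ?_)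
  refine (deltaAbs_eq_iff _ i hj).trans ?_
  change _ ↔ (deltaAbs φ).1 ((deltaAbs φ').1 i) = j
  rw [deltaAbs_eq_iff φ _ hj]
  change φ'.toOrderHom (φ.toOrderHom (finPred j)) < i ∧
    i ≤ φ'.toOrderHom (φ.toOrderHom j) ↔ _
  constructor
  · rintro ⟨h1, h2⟩
    exact deltaAbs_mem_Ioc φ' h1 h2
  · rintro ⟨h1, h2⟩
    have hp0 : (deltaAbs φ').1 i ≠ 0 := fun h => absurd (h ▸ h1) (Fin.not_lt_zero _)
    obtain ⟨g1, g2⟩ := (deltaAbs_eq_iff φ' i hp0).1 rfl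
    exact ⟨lt_of_le_of_lt (mono (le_finPred_of_lt h1)) g1, le_trans g2 (mono h2)⟩

lemma DInert.inert_deltaAbs {n m : ℕ} {φ : SimplexCategory.mk n ⟶ SimplexCategory.mk m}
    (h : DInert φ) : FinPtd.Inert (deltaAbs φ) := by
  intro j hj
  have hj0 : j.1 ≠ 0 := fun h0 => hj (Fin.ext h0)
  have e1 : (φ.toOrderHom j).1 = (φ.toOrderHom 0).1 + j.1 := h j
  have e2 : (φ.toOrderHom (finPred j)).1 = (φ.toOrderHom 0).1 + (j.1 - 1) := h (finPred j)
  have lt_of_val : φ.toOrderHom (finPred j) < φ.toOrderHom j := by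
    rw [Fin.lt_def]
    omega
  refine ⟨φ.toOrderHom j, (deltaAbs_eq_iff φ _ hj).2 ⟨lt_of_val, le_rfl⟩, fun i hi => ?_⟩
  obtain ⟨h1, h2⟩ := (deltaAbs_eq_iff φ i hj).1 hi
  rw [Fin.lt_def] at h1
  rw [Fin.le_def] at h2
  apply Fin.ext
  omega

lemma DActive.active_deltaAbs {n m : ℕ} {φ : SimplexCategory.mk n ⟶ SimplexCategory.mk m}
    (h : DActive φ) : FinPtd.Active (deltaAbs φ) := by
  obtain ⟨h0, hlast⟩ := h
  intro i hi
  by_contra hne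
  have ha : φ.toOrderHom 0 < i := by
    rw [h0]
    exact Fin.pos_of_ne_zero hne
  have hb : i ≤ φ.toOrderHom (Fin.last n) := le_of_le_of_eq (Fin.le_last i) hlast.symm
  exact absurd hi (deltaAbs_mem_Ioc φ ha hb).1.ne'

/-- The assignments `[n] ↦ ⟨n⟩` and `φ ↦ |φ|` (implemented by `deltaAbs`,
which is defined by exactly the formula `|φ|(i) = j` if `φ(j−1) < i ≤ φ(j)` for some `j`
and `|φ|(i) = 0` otherwise) define a functor `|–| : Δᵒᵖ → ℱ*`: it sends identities to
identities and reverses composition; moreover it takes inert morphisms of `Δ` to inert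
morphisms of `ℱ*` and active morphisms of `Δ` to active morphisms of `ℱ*`. -/
theorem deltaAbs_functor_preserves_inert_active :
    (∀ n : ℕ, deltaAbs (𝟙 (SimplexCategory.mk n)) = 𝟙 (FinPtd.mk n)) ∧
    (∀ (n m k : ℕ) (φ : SimplexCategory.mk n ⟶ SimplexCategory.mk m)
        (φ' : SimplexCategory.mk m ⟶ SimplexCategory.mk k),
        deltaAbs (φ ≫ φ') = deltaAbs φ' ≫ deltaAbs φ) ∧
    (∀ (n m : ℕ) (φ : SimplexCategory.mk n ⟶ SimplexCategory.mk m),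
        DInert φ → FinPtd.Inert (deltaAbs φ)) ∧
    (∀ (n m : ℕ) (φ : SimplexCategory.mk n ⟶ SimplexCategory.mk m),
        DActive φ → FinPtd.Active (deltaAbs φ)) := by
  exact ⟨deltaAbs_id, fun _ _ _ => deltaAbs_comp, fun _ _ _ => DInert.inert_deltaAbs,
    fun _ _ _ => DActive.active_deltaAbs⟩
end

section
/- Suppose given a commutative square of functors, with R̄:E→E' lying over R:B→B' via Grothendieck fibrations p:E→B and p':E'→B', such that: (i) R̄ takes p-cartesian morphisms to p'-cartesian morphisms; (ii) R has a left adjoint L:B'→B; and (iii) for every object x∈B', the composite functor E_{Lx} → E'_{RLx} → E'_x, given by the restriction of R̄ to fibers followed by cartesian transport uₓ* along the unit morphism uₓ:x→RLx, admits a left adjoint L̄ₓ:E'_x→E_{Lx}. Then R̄ admits a left adjoint L̄:E'→E lying over L (i.e. p∘L̄ is naturally isomorphic to L∘p') whose restriction to each fiber E'_x is L̄ₓ. -/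
open CategoryTheory

universe v₁ u₁ v₂ u₂ v₃ u₃ v₄ u₄

section Fibration

variable {E : Type u₁} [Category.{v₁} E] {B : Type u₂} [Category.{v₂} B]

/-- A morphism `ψ : e' ⟶ e` is `p`-cartesian if every morphism `θ : e'' ⟶ e` factors
uniquely through `ψ` over any given factorization of `p(θ)` through `p(ψ)`. -/
def IsCartesianAt (p : E ⥤ B) {e' e : E} (ψ : e' ⟶ e) : Prop :=
  ∀ {e'' : E} (θ : e'' ⟶ e) (u : p.obj e'' ⟶ p.obj e'), u ≫ p.map ψ = p.map θ →
    ∃! χ : e'' ⟶ e', p.map χ = u ∧ χ ≫ ψ = θ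

/-- `p : E ⥤ B` is a Grothendieck fibration: every morphism of `B` with target the image
of an object of `E` admits a cartesian lift with that target. -/
def IsGrothendieckFibration (p : E ⥤ B) : Prop :=
  ∀ {x : B} {e : E} (u : x ⟶ p.obj e), ∃ (e' : E) (ψ : e' ⟶ e) (h : p.obj e' = x),
    IsCartesianAt p ψ ∧ p.map ψ = eqToHom h ≫ u

end Fibration

section Stmt19

variable {E : Type u₁} [Category.{v₁} E] {B : Type u₂} [Category.{v₂} B]
  {E' : Type u₃} [Category.{v₃} E'] {B' : Type u₄} [Category.{v₄} B']

/-- Given a strictly commuting square `p' ∘ R̄ = R ∘ p` and a left adjoint `L ⊣ R`, this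
expresses that `(ℓ, η)` is a universal arrow from `e'` (an object of the fiber `E'_x`) to
the composite functor `E_{Lx} → E'_{RLx} → E'_x` given by `R̄` followed by cartesian
transport along the unit `uₓ : x → RLx`; equivalently, `η : e' ⟶ R̄ℓ` lies over the unit
`uₓ` and is universal among morphisms lying over `uₓ` into images of objects of the fiber
`E_{Lx}`.  This is precisely the statement that `ℓ` is the value of a left adjoint `L̄ₓ`
of that composite at `e'`, with unit `η`. -/
def FibUnivProp (p : E ⥤ B) (p' : E' ⥤ B') (R : B ⥤ B') (Rb : E ⥤ E')
    (hsq : Rb ⋙ p' = p ⋙ R) {L : B' ⥤ B} (adj : L ⊣ R)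
    (x : B') (e' : E') (he' : p'.obj e' = x)
    (ℓ : E) (hℓ : p.obj ℓ = L.obj x) (η : e' ⟶ Rb.obj ℓ) : Prop :=
  (p'.map η = eqToHom he' ≫ adj.unit.app x ≫
      eqToHom (((Functor.congr_obj hsq ℓ).trans (congrArg R.obj hℓ)).symm)) ∧
  ∀ (d : E) (hd : p.obj d = L.obj x) (θ : e' ⟶ Rb.obj d),
    p'.map θ = eqToHom he' ≫ adj.unit.app x ≫
        eqToHom (((Functor.congr_obj hsq d).trans (congrArg R.obj hd)).symm) →
    ∃! χ : ℓ ⟶ d, p.map χ = eqToHom (hℓ.trans hd.symm) ∧ η ≫ Rb.map χ = θ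

/-- A morphism over the unit followed by the image of `χ` lies over the transpose of `p(χ)`. -/
lemma map_comp_map_of_over_unit {p : E ⥤ B} {p' : E' ⥤ B'} {R : B ⥤ B'} {Rb : E ⥤ E'}
    (hsq : Rb ⋙ p' = p ⋙ R) {L : B' ⥤ B} (adj : L ⊣ R) {e' : E'} {ℓ d : E}
    (hℓ : p.obj ℓ = L.obj (p'.obj e')) {η : e' ⟶ Rb.obj ℓ}
    (hη : p'.map η = adj.unit.app (p'.obj e') ≫
      eqToHom (((Functor.congr_obj hsq ℓ).trans (congrArg R.obj hℓ)).symm)) (χ : ℓ ⟶ d) :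
    p'.map (η ≫ Rb.map χ) =
      adj.homEquiv _ _ (eqToHom hℓ.symm ≫ p.map χ) ≫ eqToHom (Functor.congr_obj hsq d).symm := by
  have h := Functor.congr_hom hsq χ
  simp only [Functor.comp_map] at h
  rw [p'.map_comp, hη, h, Adjunction.homEquiv_unit, R.map_comp, eqToHom_map]
  simp

/-- A fiberwise universal arrow is universal among all morphisms into images under `Rb`. -/
lemma FibUnivProp.existsUnique {p : E ⥤ B} {p' : E' ⥤ B'} {R : B ⥤ B'} {Rb : E ⥤ E'}
    {hsq : Rb ⋙ p' = p ⋙ R} (hp : IsGrothendieckFibration p)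
    (hcart : ∀ {e₁ e₂ : E} (ψ : e₁ ⟶ e₂), IsCartesianAt p ψ → IsCartesianAt p' (Rb.map ψ))
    {L : B' ⥤ B} {adj : L ⊣ R} {e' : E'} {ℓ : E} {hℓ : p.obj ℓ = L.obj (p'.obj e')}
    {η : e' ⟶ Rb.obj ℓ} (hη : FibUnivProp p p' R Rb hsq adj (p'.obj e') e' rfl ℓ hℓ η)
    {d : E} (θ : e' ⟶ Rb.obj d) : ∃! χ : ℓ ⟶ d, η ≫ Rb.map χ = θ := by
  obtain ⟨hover, huniv⟩ := hη
  simp only [eqToHom_refl, Category.id_comp] at hover huniv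
  obtain ⟨g, hg⟩ := (adj.homEquiv (p'.obj e') (p.obj d)).surjective
    (p'.map θ ≫ eqToHom (Functor.congr_obj hsq d))
  obtain ⟨d₀, ψ, hd₀, hψ, hψg⟩ := hp g
  have hRψ : IsCartesianAt p' (Rb.map ψ) := hcart ψ hψ
  have hfac : (adj.unit.app (p'.obj e') ≫
      eqToHom (((Functor.congr_obj hsq d₀).trans (congrArg R.obj hd₀)).symm)) ≫
        p'.map (Rb.map ψ) = p'.map θ := by
    have h := Functor.congr_hom hsq ψ
    simp only [Functor.comp_map] at h
    rw [Adjunction.homEquiv_unit] at hg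
    rw [h, hψg, R.map_comp, eqToHom_map]
    simp [reassoc_of% hg]
  obtain ⟨θ₀, ⟨hθ₀, hθ₀ψ⟩, hθ₀_unique⟩ := hRψ θ _ hfac
  obtain ⟨χ₀, ⟨hχ₀, hηχ₀⟩, hχ₀_unique⟩ := huniv d₀ hd₀ θ₀ hθ₀
  refine ⟨χ₀ ≫ ψ, by simp [reassoc_of% hηχ₀, hθ₀ψ], fun χ hχ ↦ ?_⟩
  have hpχ : eqToHom hℓ.symm ≫ p.map χ = g := by
    apply (adj.homEquiv _ _).injective
    rw [hg, ← hχ, map_comp_map_of_over_unit hsq adj hℓ hover]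
    simp
  obtain ⟨χ₁, ⟨hχ₁, rfl⟩, -⟩ := hψ χ (eqToHom (hℓ.trans hd₀.symm)) (by
    rw [hψg, ← hpχ]; simp)
  rw [hχ₀_unique χ₁ ⟨hχ₁, hθ₀_unique _ ⟨?_, by simpa using hχ⟩⟩]
  rw [map_comp_map_of_over_unit hsq adj hℓ hover, hχ₁, Adjunction.homEquiv_unit]
  simp [eqToHom_map]

/-- A choice of universal arrows `η e' : e' ⟶ G (F₀ e')` assembles to a left adjoint of `G`
with these arrows as unit. -/
lemma exists_leftAdjoint_of_universal_arrows (G : E ⥤ E') (F₀ : E' → E)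
    (η : ∀ e', e' ⟶ G.obj (F₀ e'))
    (h : ∀ (e' : E') (d : E) (θ : e' ⟶ G.obj d), ∃! χ : F₀ e' ⟶ d, η e' ≫ G.map χ = θ) :
    ∃ (F : E' ⥤ E) (adj : F ⊣ G) (hobj : ∀ e', F.obj e' = F₀ e'),
      ∀ e', adj.unit.app e' = η e' ≫ G.map (eqToHom (hobj e').symm) := by
  let e (X : E') (Y : E) : (F₀ X ⟶ Y) ≃ (X ⟶ G.obj Y) :=
    Equiv.ofBijective (fun χ ↦ η X ≫ G.map χ)
      ((Function.bijective_iff_existsUnique _).2 (h X Y))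
  have he : ∀ X Y Y' g k, e X Y' (k ≫ g) = e X Y k ≫ G.map g := fun X Y Y' g k ↦ by simp [e]
  exact ⟨Adjunction.leftAdjointOfEquiv e he, Adjunction.adjunctionOfEquivLeft e he, fun _ ↦ rfl,
    fun X ↦ by simp [Adjunction.adjunctionOfEquivLeft, e]⟩

/-- Given a strictly commuting square of functors with `p`, `p'`
Grothendieck fibrations, such that (i) `R̄` preserves cartesian morphisms, (ii) `R` has a
left adjoint `L`, and (iii) for every `x ∈ B'` the composite `E_{Lx} → E'_{RLx} → E'_x`
(restriction of `R̄` followed by cartesian transport along the unit) has a left adjoint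
(expressed pointwise by universal arrows), then `R̄` admits a left adjoint `L̄` lying over
`L` whose restriction to each fiber is the fiberwise left adjoint (i.e. whose unit
satisfies the same fiberwise universal property). -/
theorem fibered_left_adjoint
    (p : E ⥤ B) (p' : E' ⥤ B') (R : B ⥤ B') (Rb : E ⥤ E')
    (hsq : Rb ⋙ p' = p ⋙ R)
    (hp : IsGrothendieckFibration p) (hp' : IsGrothendieckFibration p')
    (hcart : ∀ {e₁ e₂ : E} (ψ : e₁ ⟶ e₂), IsCartesianAt p ψ → IsCartesianAt p' (Rb.map ψ))
    (L : B' ⥤ B) (adj : L ⊣ R)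
    (hfib : ∀ (x : B') (e' : E') (he' : p'.obj e' = x),
      ∃ (ℓ : E) (hℓ : p.obj ℓ = L.obj x) (η : e' ⟶ Rb.obj ℓ),
        FibUnivProp p p' R Rb hsq adj x e' he' ℓ hℓ η) :
    ∃ (Lb : E' ⥤ E) (adjb : Lb ⊣ Rb),
      Nonempty (Lb ⋙ p ≅ p' ⋙ L) ∧
      ∀ e' : E', ∃ h : p.obj (Lb.obj e') = L.obj (p'.obj e'),
        FibUnivProp p p' R Rb hsq adj (p'.obj e') e' rfl (Lb.obj e') h
          (adjb.unit.app e') := by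
  choose F₀ hF₀ η hη using fun e' : E' ↦ hfib (p'.obj e') e' rfl
  obtain ⟨Lb, adjb, hobj, hunit⟩ := exists_leftAdjoint_of_universal_arrows Rb F₀ η
    fun e' _ θ ↦ (hη e').existsUnique hp hcart θ
  obtain rfl : Lb.obj = F₀ := funext hobj
  obtain rfl : (fun e' ↦ adjb.unit.app e') = η := funext fun e' ↦ by simpa using hunit e'
  refine ⟨Lb, adjb, ⟨NatIso.ofComponents (fun e' ↦ eqToIso (hF₀ e')) fun {X Y} f ↦ ?_⟩,
    fun e' ↦ ⟨hF₀ e', hη e'⟩⟩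
  have hover (e' : E') := (hη e').1
  simp only [eqToHom_refl, Category.id_comp] at hover
  have h := map_comp_map_of_over_unit hsq adj (hF₀ X) (hover X) (Lb.map f)
  rw [adjb.unit_naturality, p'.map_comp, hover Y] at h
  have key : eqToHom (hF₀ X).symm ≫ p.map (Lb.map f) ≫ eqToHom (hF₀ Y) = L.map (p'.map f) := by
    apply (adj.homEquiv _ _).injective
    rw [← Category.assoc, Adjunction.homEquiv_naturality_right, ← cancel_mono
      (eqToHom (((Functor.congr_obj hsq (Lb.obj Y)).trans (congrArg R.obj (hF₀ Y))).symm))]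
    rw [eqToHom_map, Category.assoc, eqToHom_trans, ← h, Adjunction.homEquiv_unit]
    simp
  simp [← key]

end Stmt19
end
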